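/- Let X be a random walk bridge on ⟦0,N⟧ from u to u (u > 0) whose increments satisfy the convexity (log-concavity) and exponential-moment assumptions. Then there exist c > 0 and N₀ ∈ ℕ such that for all N ≥ N₀, P(max_{1 ≤ j ≤ N-1} X(j) > 2u) ≤ 4·exp(-c·min(u²/N, u)). -/

import Mathlib

open MeasureTheory Real
open scoped ENNReal

noncomputable section

/-- The full trajectory over `⟦0, n+1⟧` of a bridge with boundary values `u, v`
and interior values `q`. -/
def pathOf (u v : ℝ) (n : ℕ) (q : Fin n → ℝ) : ℕ → ℝ :=
  fun t => if h : 1 ≤ t ∧ t ≤ n then q ⟨t - 1, by omega⟩ else if t = 0 then u else v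

/-- Unnormalized density of a random walk bridge on `⟦0, n+1⟧` from `u` to `v`,
with increment Hamiltonian `H`: the product of `exp(-H(increment))` over all steps. -/
def bridgeDensity (H : ℝ → ℝ) (u v : ℝ) (n : ℕ) (q : Fin n → ℝ) : ℝ :=
  ∏ j ∈ Finset.range (n + 1),
    Real.exp (-(H (pathOf u v n q (j + 1) - pathOf u v n q j)))

/-- The (unnormalized) law of the interior points of a random walk bridge. -/
def bridgeMeasure (H : ℝ → ℝ) (u v : ℝ) (n : ℕ) : Measure (Fin n → ℝ) :=
  volume.withDensity fun q => ENNReal.ofReal (bridgeDensity H u v n q)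

open scoped Classical in
/-- The (unnormalized) law of a random walk bridge on `⟦0, n+1⟧` from `u` to `v`
constrained to stay above the floor in the interior, with area tilt
`exp(-c · Σ_j (X(j) - floor(j)))`. -/
def tiltedMeasure (H : ℝ → ℝ) (u v : ℝ) (n : ℕ) (c : ℝ) (floor : ℕ → ℝ) :
    Measure (Fin n → ℝ) :=
  volume.withDensity fun q =>
    ENNReal.ofReal (bridgeDensity H u v n q
      * Real.exp (-(c * ∑ j ∈ Finset.range (n + 1), (pathOf u v n q j - floor j)))
      * if ∀ t, 1 ≤ t → t ≤ n → floor t ≤ pathOf u v n q t then 1 else 0)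

/-- Probability of an event under the normalization of a finite measure. -/
def probOf {α : Type*} [MeasurableSpace α] (μ : Measure α) (E : Set α) : ℝ≥0∞ :=
  μ E / μ Set.univ

/-- The normalized (probability) version of a measure. -/
def normalizeMeasure {α : Type*} [MeasurableSpace α] (μ : Measure α) : Measure α :=
  (μ Set.univ)⁻¹ • μ

/-- Fluctuation scale `H_λ = λ^{-1/3} N^{1/3}`. -/
def Hlam (lam N : ℝ) : ℝ := lam ^ (-(1 : ℝ) / 3) * N ^ ((1 : ℝ) / 3)

/-- Assumptions on the random walk Hamiltonian: convexity (log-concavity of the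
increment density), zero mean, positive finite variance, and finite exponential
moments near zero. -/
structure RWAssumptions (H : ℝ → ℝ) : Prop where
  convex : ConvexOn ℝ Set.univ H
  integrable_exp : Integrable fun x : ℝ => Real.exp (-(H x))
  norm_pos : 0 < ∫ x : ℝ, Real.exp (-(H x))
  mean_zero : (∫ x : ℝ, x * Real.exp (-(H x))) = 0
  integrable_sq : Integrable fun x : ℝ => x ^ 2 * Real.exp (-(H x))
  var_pos : 0 < ∫ x : ℝ, x ^ 2 * Real.exp (-(H x))
  mgf : ∃ t₀ > 0, ∀ t : ℝ, |t| ≤ t₀ →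
    Integrable fun x : ℝ => Real.exp (t * x) * Real.exp (-(H x))

end

/-- The unnormalized law of `X + Y`, where `X` has density `f` and `Y` has density `g`. -/
noncomputable def lconvol (f g : ℝ → ℝ≥0∞) (v : ℝ) : ℝ≥0∞ := ∫⁻ x, f (v - x) * g x

/-- The exponential moment of order `s` of the density `f`. -/
noncomputable def expMoment (f : ℝ → ℝ≥0∞) (s : ℝ) : ℝ≥0∞ :=
  ∫⁻ x, ENNReal.ofReal (Real.exp (s * x)) * f x

/-- The densities of the walk started at `u` after `n + 1` steps with density `f`, restricted
to the event that one of the first `n` positions exceeds `a`, and to its complement. -/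
noncomputable def crossingDensities (f : ℝ → ℝ≥0∞) (u a : ℝ) :
    ℕ → (ℝ → ℝ≥0∞) × (ℝ → ℝ≥0∞)
  | 0 => (0, fun v => f (v - u))
  | n + 1 =>
    (lconvol f ((crossingDensities f u a n).1 +
        (Set.Ioi a).indicator (crossingDensities f u a n).2),
      lconvol f ((Set.Iic a).indicator (crossingDensities f u a n).2))

section Kernel

variable {f g h : ℝ → ℝ≥0∞}

lemma measurable_lconvol (hf : Measurable f) (hg : Measurable g) :
    Measurable (lconvol f g) := by
  unfold lconvol
  apply Measurable.lintegral_prod_right'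
    (f := fun p : ℝ × ℝ => f (p.1 - p.2) * g p.2)
  fun_prop

lemma lconvol_add (hf : Measurable f) (hg : Measurable g) :
    lconvol f (g + h) = lconvol f g + lconvol f h := by
  funext v
  simp only [lconvol, Pi.add_apply, mul_add]
  exact lintegral_add_left (by fun_prop) _

lemma expMoment_add (hg : Measurable g) (s : ℝ) :
    expMoment (g + h) s = expMoment g s + expMoment h s := by
  simp only [expMoment, Pi.add_apply, mul_add]
  exact lintegral_add_left (by fun_prop) _

lemma expMoment_comp_sub_right (u s : ℝ) :
    expMoment (fun v => f (v - u)) s = ENNReal.ofReal (Real.exp (s * u)) * expMoment f s := by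
  unfold expMoment
  rw [← lintegral_const_mul' _ _ ENNReal.ofReal_ne_top,
    ← lintegral_sub_right_eq_self
      (fun x => ENNReal.ofReal (Real.exp (s * u)) *
        (ENNReal.ofReal (Real.exp (s * x)) * f x)) u]
  refine lintegral_congr fun x => ?_
  rw [← mul_assoc, ← ENNReal.ofReal_mul (Real.exp_pos _).le, ← Real.exp_add]
  ring_nf

lemma expMoment_lconvol (hf : Measurable f) (hg : Measurable g) (s : ℝ) :
    expMoment (lconvol f g) s = expMoment f s * expMoment g s := by
  have hswap : expMoment (lconvol f g) s =
      ∫⁻ v, ∫⁻ x, ENNReal.ofReal (Real.exp (s * v)) * (f (v - x) * g x) := by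
    simp only [expMoment, lconvol]
    exact lintegral_congr fun v => (lintegral_const_mul' _ _ ENNReal.ofReal_ne_top).symm
  rw [hswap, lintegral_lintegral_swap (by fun_prop)]
  have hinner : ∀ x, ∫⁻ v, ENNReal.ofReal (Real.exp (s * v)) * (f (v - x) * g x) =
      expMoment f s * (ENNReal.ofReal (Real.exp (s * x)) * g x) := by
    intro x
    simp only [← mul_assoc]
    rw [lintegral_mul_const _ (by fun_prop)]
    have := expMoment_comp_sub_right (f := f) x s
    rw [expMoment] at this
    rw [this, mul_comm (ENNReal.ofReal _)]
  simp only [hinner]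
  exact lintegral_const_mul _ (by fun_prop)

/-- Integrating against a totally positive kernel preserves the monotone likelihood ratio. -/
lemma lconvol_mul_lconvol_le (hf : Measurable f) (hg : Measurable g) (hh : Measurable h)
    (hker : ∀ x y t s, x ≤ y → t ≤ s → f (x - s) * f (y - t) ≤ f (y - s) * f (x - t))
    (hgh : ∀ t s, t ≤ s → g t * h s ≤ g s * h t) {x y : ℝ} (hxy : x ≤ y) :
    lconvol f g x * lconvol f h y ≤ lconvol f g y * lconvol f h x := by
  have hprod : ∀ p q : ℝ, lconvol f g p * lconvol f h q =
      ∫⁻ s, ∫⁻ t, (f (p - s) * g s) * (f (q - t) * h t) := by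
    intro p q
    rw [lconvol, ← lintegral_mul_const _ (by fun_prop)]
    refine lintegral_congr fun s => ?_
    rw [lconvol, lintegral_const_mul _ (by fun_prop)]
  have hprod' : ∀ p q : ℝ, lconvol f g p * lconvol f h q =
      ∫⁻ s, ∫⁻ t, (f (p - t) * g t) * (f (q - s) * h s) := by
    intro p q
    rw [hprod, lintegral_lintegral_swap (by fun_prop)]
  have hdouble : ∀ p q : ℝ, lconvol f g p * lconvol f h q + lconvol f g p * lconvol f h q =
      ∫⁻ s, ∫⁻ t, ((f (p - s) * g s) * (f (q - t) * h t) +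
        (f (p - t) * g t) * (f (q - s) * h s)) := by
    intro p q
    nth_rewrite 1 [hprod]
    rw [hprod', ← lintegral_add_left]
    · refine lintegral_congr fun s => ?_
      rw [← lintegral_add_left (by fun_prop)]
    · apply Measurable.lintegral_prod_right'
        (f := fun z : ℝ × ℝ => (f (p - z.1) * g z.1) * (f (q - z.2) * h z.2))
      fun_prop
  have rearrange : ∀ {A B c d : ℝ≥0∞}, B ≤ A → d ≤ c → A * d + B * c ≤ A * c + B * d := by
    intro A B c d hBA hdc
    obtain ⟨e, rfl⟩ := exists_add_of_le hBA
    obtain ⟨k, rfl⟩ := exists_add_of_le hdc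
    calc (B + e) * d + B * (d + k) ≤ (B + e) * d + B * (d + k) + e * k := le_self_add
      _ = (B + e) * (d + k) + B * d := by ring
  have key : lconvol f g x * lconvol f h y + lconvol f g x * lconvol f h y ≤
      lconvol f g y * lconvol f h x + lconvol f g y * lconvol f h x := by
    rw [hdouble, hdouble]
    refine lintegral_mono fun s => lintegral_mono fun t => ?_
    rcases le_total t s with hts | hst
    · have := rearrange (hgh t s hts) (hker x y t s hxy hts)
      convert this using 1 <;> ring
    · have := rearrange (hgh s t hst) (hker x y s t hxy hst)
      convert this using 1 <;> ring
  rw [← two_mul, ← two_mul] at key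
  exact (ENNReal.mul_le_mul_iff_right (by norm_num) (by norm_num)).1 key

lemma measurable_crossingDensities (hf : Measurable f) (u a : ℝ) (n : ℕ) :
    Measurable (crossingDensities f u a n).1 ∧ Measurable (crossingDensities f u a n).2 := by
  induction n with
  | zero =>
    refine ⟨measurable_const, ?_⟩
    simp only [crossingDensities]
    fun_prop
  | succ n ih =>
    exact ⟨measurable_lconvol hf (ih.1.add (ih.2.indicator measurableSet_Ioi)),
      measurable_lconvol hf (ih.2.indicator measurableSet_Iic)⟩

/-- Conditioning on a higher endpoint makes a crossing of the level `a` more likely. -/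
lemma crossingDensities_likelihood_ratio (hf : Measurable f)
    (hker : ∀ x y t s, x ≤ y → t ≤ s → f (x - s) * f (y - t) ≤ f (y - s) * f (x - t))
    (u a : ℝ) (n : ℕ) {t s : ℝ} (hts : t ≤ s) :
    (crossingDensities f u a n).1 t * (crossingDensities f u a n).2 s ≤
      (crossingDensities f u a n).1 s * (crossingDensities f u a n).2 t := by
  induction n generalizing t s with
  | zero => simp [crossingDensities]
  | succ n ih =>
    obtain ⟨hm1, hm2⟩ := measurable_crossingDensities hf u a n
    refine lconvol_mul_lconvol_le hf (hm1.add (hm2.indicator measurableSet_Ioi))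
      (hm2.indicator measurableSet_Iic) hker ?_ hts
    intro t s hts
    by_cases hs : s ≤ a
    · have ht : t ≤ a := hts.trans hs
      simpa [Set.indicator, hs, ht, hs.not_gt, ht.not_gt] using ih hts
    · simp [Set.indicator, hs]

lemma expMoment_crossingDensities_add (hf : Measurable f) (u a : ℝ) (n : ℕ) (s : ℝ) :
    expMoment ((crossingDensities f u a n).1 + (crossingDensities f u a n).2) s =
      ENNReal.ofReal (Real.exp (s * u)) * expMoment f s ^ (n + 1) := by
  induction n with
  | zero =>
    simp only [crossingDensities, zero_add, pow_one]
    exact expMoment_comp_sub_right u s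
  | succ n ih =>
    obtain ⟨hm1, hm2⟩ := measurable_crossingDensities hf u a n
    have hsplit : (crossingDensities f u a n).1 +
        (Set.Ioi a).indicator (crossingDensities f u a n).2 +
        (Set.Iic a).indicator (crossingDensities f u a n).2 =
        (crossingDensities f u a n).1 + (crossingDensities f u a n).2 := by
      rw [add_assoc, ← Set.compl_Iic, Set.indicator_compl_add_self]
    simp only [crossingDensities]
    rw [← lconvol_add hf (hm1.add (hm2.indicator measurableSet_Ioi)), hsplit,
      expMoment_lconvol hf (hm1.add hm2), ih]
    ring

/-- Doob's maximal inequality for the exponential of the walk. -/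
lemma expMoment_crossingDensities_le (hf : Measurable f) (u a : ℝ) {t : ℝ} (ht : 0 ≤ t)
    (hmono : expMoment f 0 ≤ expMoment f t) (n : ℕ) :
    ENNReal.ofReal (Real.exp (t * a)) * expMoment (crossingDensities f u a n).1 0 +
        expMoment (crossingDensities f u a n).2 t ≤
      ENNReal.ofReal (Real.exp (t * u)) * expMoment f t ^ (n + 1) := by
  induction n with
  | zero =>
    simp only [crossingDensities, zero_add, pow_one]
    rw [expMoment_comp_sub_right]
    simp [expMoment]
  | succ n ih =>
    obtain ⟨hm1, hm2⟩ := measurable_crossingDensities hf u a n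
    simp only [crossingDensities]
    rw [expMoment_lconvol hf (hm1.add (hm2.indicator measurableSet_Ioi)),
      expMoment_lconvol hf (hm2.indicator measurableSet_Iic), expMoment_add hm1]
    have hmarkov : ENNReal.ofReal (Real.exp (t * a)) *
        expMoment ((Set.Ioi a).indicator (crossingDensities f u a n).2) 0 ≤
        expMoment ((Set.Ioi a).indicator (crossingDensities f u a n).2) t := by
      unfold expMoment
      rw [← lintegral_const_mul' _ _ ENNReal.ofReal_ne_top]
      refine lintegral_mono fun x => ?_
      by_cases hx : a < x
      · simp only [zero_mul, Real.exp_zero, ENNReal.ofReal_one, one_mul]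
        gcongr
      · simp [hx]
    have hsplit : expMoment ((Set.Ioi a).indicator (crossingDensities f u a n).2) t +
        expMoment ((Set.Iic a).indicator (crossingDensities f u a n).2) t =
        expMoment (crossingDensities f u a n).2 t := by
      rw [← expMoment_add (hm2.indicator measurableSet_Ioi), ← Set.compl_Iic,
        Set.indicator_compl_add_self]
    calc _ ≤ ENNReal.ofReal (Real.exp (t * a)) * (expMoment f t *
            (expMoment (crossingDensities f u a n).1 0 +
              expMoment ((Set.Ioi a).indicator (crossingDensities f u a n).2) 0)) +
          expMoment f t * expMoment ((Set.Iic a).indicator (crossingDensities f u a n).2) t := by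
          gcongr
      _ = expMoment f t * (ENNReal.ofReal (Real.exp (t * a)) *
            expMoment (crossingDensities f u a n).1 0 +
          (ENNReal.ofReal (Real.exp (t * a)) *
            expMoment ((Set.Ioi a).indicator (crossingDensities f u a n).2) 0 +
          expMoment ((Set.Iic a).indicator (crossingDensities f u a n).2) t)) := by ring
      _ ≤ expMoment f t * (ENNReal.ofReal (Real.exp (t * a)) *
            expMoment (crossingDensities f u a n).1 0 +
          (expMoment ((Set.Ioi a).indicator (crossingDensities f u a n).2) t +
          expMoment ((Set.Iic a).indicator (crossingDensities f u a n).2) t)) := by gcongr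
      _ ≤ expMoment f t * (ENNReal.ofReal (Real.exp (t * u)) * expMoment f t ^ (n + 1)) := by
          rw [hsplit]
          gcongr
      _ = _ := by ring

/-- The stochastic comparison of the bridge with the walk ending above the endpoint. -/
lemma crossingDensities_mul_setLIntegral_le (hf : Measurable f)
    (hker : ∀ x y t s, x ≤ y → t ≤ s → f (x - s) * f (y - t) ≤ f (y - s) * f (x - t))
    (u a v : ℝ) (n : ℕ) :
    (crossingDensities f u a n).1 v *
        ∫⁻ y in Set.Ici v, ((crossingDensities f u a n).1 + (crossingDensities f u a n).2) y ≤
      ((crossingDensities f u a n).1 + (crossingDensities f u a n).2) v *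
        expMoment (crossingDensities f u a n).1 0 := by
  obtain ⟨hm1, hm2⟩ := measurable_crossingDensities hf u a n
  rw [← lintegral_const_mul _ (hm1.add hm2)]
  calc _ ≤ ∫⁻ y in Set.Ici v,
        ((crossingDensities f u a n).1 + (crossingDensities f u a n).2) v *
          (crossingDensities f u a n).1 y := by
        refine setLIntegral_mono (hm1.const_mul _) fun y hy => ?_
        have := crossingDensities_likelihood_ratio hf hker u a n (Set.mem_Ici.1 hy)
        simp only [Pi.add_apply, mul_add, add_mul]
        rw [mul_comm ((crossingDensities f u a n).2 v)]
        gcongr ?_ + ?_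
        exact le_rfl
    _ ≤ ∫⁻ y, ((crossingDensities f u a n).1 + (crossingDensities f u a n).2) v *
          (crossingDensities f u a n).1 y := setLIntegral_le_lintegral _ _
    _ = _ := by
        rw [lintegral_const_mul _ hm1]
        simp [expMoment]

end Kernel

section Path

lemma pathOf_insertNth_last_of_le (u v x : ℝ) {n : ℕ} (q : Fin n → ℝ) {t : ℕ}
    (ht : t ≤ n + 1) :
    pathOf u v (n + 1) (Fin.insertNth (α := fun _ => ℝ) (Fin.last n) x q) t =
      pathOf u x n q t := by
  unfold pathOf
  rcases Nat.eq_zero_or_pos t with rfl | ht0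
  · simp
  · rcases ht.lt_or_eq with hlt | rfl
    · have h1 : 1 ≤ t ∧ t ≤ n + 1 := ⟨ht0, ht⟩
      have h2 : 1 ≤ t ∧ t ≤ n := ⟨ht0, by omega⟩
      rw [dif_pos h1, dif_pos h2, Fin.insertNth_last']
      exact Fin.snoc_castSucc (α := fun _ => ℝ) x q ⟨t - 1, by omega⟩
    · rw [dif_pos ⟨by omega, le_rfl⟩, dif_neg (by omega), if_neg (by omega)]
      exact Fin.insertNth_apply_same (α := fun _ => ℝ) (Fin.last n) x q

lemma pathOf_last (u v : ℝ) (n : ℕ) (q : Fin n → ℝ) : pathOf u v n q (n + 1) = v := by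
  simp [pathOf]

lemma measurable_pathOf (u v : ℝ) (n t : ℕ) : Measurable fun q => pathOf u v n q t := by
  unfold pathOf
  by_cases h : 1 ≤ t ∧ t ≤ n
  · simp only [dif_pos h]
    exact measurable_pi_apply _
  · simp only [dif_neg h]
    exact measurable_const

/-- The interior configurations of bridges which exceed the level `a`. -/
def crossingSet (u v a : ℝ) (n : ℕ) : Set (Fin n → ℝ) :=
  {q | ∃ j, 1 ≤ j ∧ j ≤ n ∧ a < pathOf u v n q j}

lemma measurableSet_crossingSet (u v a : ℝ) (n : ℕ) :
    MeasurableSet (crossingSet u v a n) := by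
  have : crossingSet u v a n =
      ⋃ j, ⋃ (_ : 1 ≤ j), ⋃ (_ : j ≤ n), {q | a < pathOf u v n q j} := by
    ext q
    simp only [crossingSet, Set.mem_ofPred_eq, Set.mem_iUnion, exists_prop]
  rw [this]
  exact .iUnion fun j => .iUnion fun _ => .iUnion fun _ =>
    measurableSet_lt measurable_const (measurable_pathOf u v n j)

lemma insertNth_last_mem_crossingSet (u v x a : ℝ) {n : ℕ} (q : Fin n → ℝ) :
    Fin.insertNth (α := fun _ => ℝ) (Fin.last n) x q ∈ crossingSet u v a (n + 1) ↔
      q ∈ crossingSet u x a n ∨ a < x := by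
  simp only [crossingSet, Set.mem_ofPred_eq]
  constructor
  · rintro ⟨j, h1, h2, hj⟩
    rw [pathOf_insertNth_last_of_le u v x q h2] at hj
    rcases h2.lt_or_eq with h | rfl
    · exact Or.inl ⟨j, h1, by omega, hj⟩
    · rw [pathOf_last] at hj
      exact Or.inr hj
  · rintro (⟨j, h1, h2, hj⟩ | hx)
    · exact ⟨j, h1, by omega, by rwa [pathOf_insertNth_last_of_le u v x q (by omega)]⟩
    · exact ⟨n + 1, by omega, le_rfl, by
        rwa [pathOf_insertNth_last_of_le u v x q le_rfl, pathOf_last]⟩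

lemma bridgeDensity_insertNth_last (H : ℝ → ℝ) (u v x : ℝ) {n : ℕ} (q : Fin n → ℝ) :
    bridgeDensity H u v (n + 1) (Fin.insertNth (α := fun _ => ℝ) (Fin.last n) x q) =
      Real.exp (-(H (v - x))) * bridgeDensity H u x n q := by
  unfold bridgeDensity
  rw [Finset.prod_range_succ, mul_comm, pathOf_last,
    pathOf_insertNth_last_of_le u v x q le_rfl, pathOf_last]
  congr 1
  refine Finset.prod_congr rfl fun j hj => ?_
  have hj' := Finset.mem_range.1 hj
  rw [pathOf_insertNth_last_of_le u v x q (by omega),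
    pathOf_insertNth_last_of_le u v x q (by omega)]

lemma measurable_bridgeDensity {H : ℝ → ℝ} (hH : Measurable H) (u v : ℝ) (n : ℕ) :
    Measurable (bridgeDensity H u v n) := by
  unfold bridgeDensity
  refine Finset.measurable_prod _ fun j _ => ?_
  exact Real.measurable_exp.comp
    (hH.comp ((measurable_pathOf u v n _).sub (measurable_pathOf u v n _))).neg

lemma lintegral_pi_insertNth_last {n : ℕ} {F : (Fin (n + 1) → ℝ) → ℝ≥0∞}
    (hF : Measurable F) :
    ∫⁻ q, F q = ∫⁻ x : ℝ, ∫⁻ q : Fin n → ℝ,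
      F (Fin.insertNth (α := fun _ => ℝ) (Fin.last n) x q) := by
  have hmp := (volume_preserving_piFinSuccAbove (fun _ : Fin (n + 1) => ℝ) (Fin.last n)).symm
  rw [hmp.lintegral_map_equiv F, Measure.volume_eq_prod,
    lintegral_prod (fun p => F ((MeasurableEquiv.piFinSuccAbove (fun _ : Fin (n + 1) => ℝ)
      (Fin.last n)).symm p)) (hF.comp (MeasurableEquiv.measurable _)).aemeasurable]
  rfl

/-- The bridge density splits at its last interior position. -/
lemma lintegral_indicator_bridgeDensity {H : ℝ → ℝ} (hH : Measurable H) (u v a : ℝ) (n : ℕ) :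
    ∫⁻ q, (crossingSet u v a n).indicator
        (fun q => ENNReal.ofReal (bridgeDensity H u v n q)) q =
      (crossingDensities (fun x => ENNReal.ofReal (Real.exp (-(H x)))) u a n).1 v ∧
    ∫⁻ q, (crossingSet u v a n)ᶜ.indicator
        (fun q => ENNReal.ofReal (bridgeDensity H u v n q)) q =
      (crossingDensities (fun x => ENNReal.ofReal (Real.exp (-(H x)))) u a n).2 v := by
  induction n generalizing v with
  | zero =>
    have hempty : crossingSet u v a 0 = ∅ := by
      ext q
      simp only [crossingSet, Set.mem_ofPred_eq, Set.mem_empty_iff_false, iff_false]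
      omega
    constructor
    · simp [hempty, crossingDensities]
    · rw [Measure.volume_pi_eq_dirac]
      simp [hempty, crossingDensities, bridgeDensity, pathOf]
  | succ n ih =>
    have hm : ∀ (v : ℝ) (m : ℕ),
        Measurable fun q => ENNReal.ofReal (bridgeDensity H u v m q) :=
      fun v m => (measurable_bridgeDensity hH u v m).ennreal_ofReal
    have hS := measurableSet_crossingSet u
    constructor
    · rw [lintegral_pi_insertNth_last ((hm v _).indicator (hS v a _))]
      refine lintegral_congr fun x => ?_
      obtain ⟨ih1, ih2⟩ := ih x
      rw [Pi.add_apply, ← ih1]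
      by_cases hx : a < x
      · rw [Set.indicator_of_mem (Set.mem_Ioi.2 hx), ← ih2,
          ← lintegral_add_left ((hm x n).indicator (hS x a n)),
          ← lintegral_const_mul' _ _ ENNReal.ofReal_ne_top]
        refine lintegral_congr fun q => ?_
        rw [Set.indicator_self_add_compl_apply, Set.indicator_of_mem
          ((insertNth_last_mem_crossingSet u v x a q).2 (Or.inr hx)),
          bridgeDensity_insertNth_last, ENNReal.ofReal_mul (Real.exp_pos _).le]
      · rw [Set.indicator_of_notMem (by simpa using hx), add_zero,
          ← lintegral_const_mul' _ _ ENNReal.ofReal_ne_top]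
        refine lintegral_congr fun q => ?_
        by_cases hq : q ∈ crossingSet u x a n
        · rw [Set.indicator_of_mem hq, Set.indicator_of_mem
            ((insertNth_last_mem_crossingSet u v x a q).2 (Or.inl hq)),
            bridgeDensity_insertNth_last, ENNReal.ofReal_mul (Real.exp_pos _).le]
        · rw [Set.indicator_of_notMem hq, Set.indicator_of_notMem, mul_zero]
          rw [insertNth_last_mem_crossingSet]
          tauto
    · rw [lintegral_pi_insertNth_last ((hm v _).indicator (hS v a _).compl)]
      refine lintegral_congr fun x => ?_
      obtain ⟨-, ih2⟩ := ih x
      by_cases hx : a < x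
      · rw [Set.indicator_of_notMem (by simpa using hx), mul_zero]
        refine (lintegral_congr fun q => ?_).trans lintegral_zero
        exact Set.indicator_of_notMem (not_not.2
          ((insertNth_last_mem_crossingSet u v x a q).2 (Or.inr hx))) _
      · rw [Set.indicator_of_mem (by simpa using hx), ← ih2,
          ← lintegral_const_mul' _ _ ENNReal.ofReal_ne_top]
        refine lintegral_congr fun q => ?_
        by_cases hq : q ∈ crossingSet u x a n
        · rw [Set.indicator_of_notMem (not_not.2
            ((insertNth_last_mem_crossingSet u v x a q).2 (Or.inl hq))),
            Set.indicator_of_notMem (not_not.2 hq), mul_zero]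
        · have hq' : Fin.insertNth (α := fun _ => ℝ) (Fin.last n) x q ∈
              (crossingSet u v a (n + 1))ᶜ := by
            rw [Set.mem_compl_iff, insertNth_last_mem_crossingSet]
            tauto
          rw [Set.indicator_of_mem hq', Set.indicator_of_mem (Set.mem_compl hq),
            bridgeDensity_insertNth_last, ENNReal.ofReal_mul (Real.exp_pos _).le]

lemma bridgeMeasure_crossingSet {H : ℝ → ℝ} (hH : Measurable H) (u v a : ℝ) (n : ℕ) :
    bridgeMeasure H u v n (crossingSet u v a n) =
      (crossingDensities (fun x => ENNReal.ofReal (Real.exp (-(H x)))) u a n).1 v := by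
  rw [bridgeMeasure, withDensity_apply _ (measurableSet_crossingSet u v a n),
    ← lintegral_indicator (measurableSet_crossingSet u v a n)]
  exact (lintegral_indicator_bridgeDensity hH u v a n).1

lemma bridgeMeasure_univ {H : ℝ → ℝ} (hH : Measurable H) (u v a : ℝ) (n : ℕ) :
    bridgeMeasure H u v n Set.univ =
      ((crossingDensities (fun x => ENNReal.ofReal (Real.exp (-(H x)))) u a n).1 +
        (crossingDensities (fun x => ENNReal.ofReal (Real.exp (-(H x)))) u a n).2) v := by
  have hS := measurableSet_crossingSet u v a n
  rw [Pi.add_apply, ← bridgeMeasure_crossingSet hH, ← measure_add_measure_compl hS,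
    ← (lintegral_indicator_bridgeDensity hH u v a n).2, lintegral_indicator hS.compl,
    bridgeMeasure, withDensity_apply _ hS.compl]

end Path

section Exponential

lemma exp_le_one_add_add_sq_mul (y : ℝ) : Real.exp y ≤ 1 + y + y ^ 2 * Real.exp |y| := by
  have h1 : Real.exp y - 1 ≤ y * Real.exp y := by
    have := Real.add_one_le_exp (-y)
    have h2 : Real.exp (-y) * Real.exp y = 1 := by rw [← Real.exp_add]; simp
    nlinarith [Real.exp_pos y]
  rcases le_total 0 y with hy | hy
  · rw [abs_of_nonneg hy]
    nlinarith [mul_le_mul_of_nonneg_left h1 hy]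
  · have h3 := Real.add_one_le_exp y
    have h4 : 1 ≤ Real.exp |y| := Real.one_le_exp (abs_nonneg y)
    nlinarith [mul_nonneg (sq_nonneg y) (sub_nonneg.2 h4)]

lemma one_add_add_sq_max_le_exp (y : ℝ) : 1 + y + max y 0 ^ 2 / 2 ≤ Real.exp y := by
  rcases le_total 0 y with hy | hy
  · rw [max_eq_left hy]
    exact Real.quadratic_le_exp_of_nonneg hy
  · rw [max_eq_right hy]
    linarith [Real.add_one_le_exp y]

lemma exp_mul_le_of_le {t s x : ℝ} (ht : 0 < t) (hs0 : 0 ≤ s) (hst : s ≤ t / 2) :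
    Real.exp (s * x) ≤
      1 + s * x + s ^ 2 * (8 / t ^ 2 * (Real.exp (t * x) + Real.exp (-t * x))) := by
  have h1 := exp_le_one_add_add_sq_mul (s * x)
  have h2 : Real.exp |s * x| ≤ Real.exp (t / 2 * |x|) := by
    rw [abs_mul, abs_of_nonneg hs0]
    gcongr
  have h3 : (t / 2 * |x|) ^ 2 / 2 ≤ Real.exp (t / 2 * |x|) := by
    have : 0 ≤ t / 2 * |x| := by positivity
    linarith [Real.quadratic_le_exp_of_nonneg this]
  have h4 : Real.exp (t / 2 * |x|) * Real.exp (t / 2 * |x|) ≤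
      Real.exp (t * x) + Real.exp (-t * x) := by
    rw [← Real.exp_add]
    rcases le_total 0 x with hx | hx
    · rw [abs_of_nonneg hx]
      have : t / 2 * x + t / 2 * x = t * x := by ring
      rw [this]
      linarith [Real.exp_pos (-t * x)]
    · rw [abs_of_nonpos hx]
      have : t / 2 * -x + t / 2 * -x = -t * x := by ring
      rw [this]
      linarith [Real.exp_pos (t * x)]
  have h5 : x ^ 2 = 8 / t ^ 2 * ((t / 2 * |x|) ^ 2 / 2) := by
    rw [mul_pow, sq_abs]
    field_simp
    norm_num
  have h6 : x ^ 2 * Real.exp |s * x| ≤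
      8 / t ^ 2 * (Real.exp (t * x) + Real.exp (-t * x)) := by
    calc x ^ 2 * Real.exp |s * x| ≤
          (8 / t ^ 2 * Real.exp (t / 2 * |x|)) * Real.exp (t / 2 * |x|) := by
          rw [h5]
          gcongr
      _ = 8 / t ^ 2 * (Real.exp (t / 2 * |x|) * Real.exp (t / 2 * |x|)) := by ring
      _ ≤ _ := by gcongr
  calc Real.exp (s * x) ≤ 1 + s * x + s ^ 2 * (x ^ 2 * Real.exp |s * x|) := by
        rw [mul_pow] at h1
        linarith
    _ ≤ _ := by gcongr

variable {H : ℝ → ℝ}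

lemma RWAssumptions.continuous (hH : RWAssumptions H) : Continuous H :=
  continuousOn_univ.1 (hH.convex.continuousOn isOpen_univ)

/-- Two-sided quadratic bounds on the exponential moments near `0`. -/
lemma RWAssumptions.exists_expMoment_bounds (hH : RWAssumptions H) :
    ∃ Z > 0, ∃ c > 0, ∃ C > 0, ∃ t > 0,
      expMoment (fun x => ENNReal.ofReal (Real.exp (-(H x)))) 0 = ENNReal.ofReal Z ∧
      ∀ s, 0 ≤ s → s ≤ t →
        ENNReal.ofReal (Z * (1 + c * s ^ 2)) ≤
          expMoment (fun x => ENNReal.ofReal (Real.exp (-(H x)))) s ∧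
        expMoment (fun x => ENNReal.ofReal (Real.exp (-(H x)))) s ≤
          ENNReal.ofReal (Z * Real.exp (C * s ^ 2)) := by
  obtain ⟨t, ht, hint⟩ := hH.mgf
  have hcont := hH.continuous
  set w : ℝ → ℝ := fun x => Real.exp (-(H x))
  have hwpos : ∀ x, 0 < w x := fun x => Real.exp_pos _
  have hi0 : Integrable w := hH.integrable_exp
  have hi2 : Integrable fun x => x ^ 2 * w x := hH.integrable_sq
  have hip : Integrable fun x => Real.exp (t * x) * w x := hint t (abs_of_pos ht).le
  have him : Integrable fun x => Real.exp (-t * x) * w x :=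
    hint (-t) (by rw [abs_neg, abs_of_pos ht])
  have hi1 : Integrable fun x => x * w x := by
    refine (hi0.add hi2).mono' (by fun_prop) (Filter.Eventually.of_forall fun x => ?_)
    rw [norm_mul, Real.norm_eq_abs, Real.norm_eq_abs, abs_of_pos (hwpos x)]
    simp only [Pi.add_apply]
    nlinarith [hwpos x, sq_abs x, sq_nonneg (|x| - 1), abs_nonneg x,
      mul_nonneg (hwpos x).le (sq_nonneg (|x| - 1)), mul_nonneg (hwpos x).le (abs_nonneg x)]
  have hi3 : Integrable fun x => max x 0 ^ 2 * w x := by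
    refine hi2.mono' (by fun_prop) (Filter.Eventually.of_forall fun x => ?_)
    rw [Real.norm_of_nonneg (mul_nonneg (sq_nonneg _) (hwpos x).le)]
    refine mul_le_mul_of_nonneg_right ?_ (hwpos x).le
    rcases le_total 0 x with hx | hx
    · rw [max_eq_left hx]
    · rw [max_eq_right hx]
      nlinarith [sq_nonneg x]
  have hmoment : ∀ s, expMoment (fun x => ENNReal.ofReal (w x)) s =
      ∫⁻ x, ENNReal.ofReal (Real.exp (s * x) * w x) := by
    intro s
    exact lintegral_congr fun x => (ENNReal.ofReal_mul (Real.exp_pos _).le).symm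
  have hpos3 : 0 < ∫ x, max x 0 ^ 2 * w x := by
    rw [integral_pos_iff_support_of_nonneg
      (fun x => mul_nonneg (sq_nonneg _) (hwpos x).le) hi3]
    refine lt_of_lt_of_le ?_ (measure_mono (s := Set.Ioi (0 : ℝ)) fun x hx => ?_)
    · simp
    · have hx' : 0 < x := hx
      rw [Function.mem_support, max_eq_left hx'.le]
      have := hwpos x
      positivity
  set Z := ∫ x, w x with hZ
  have hZpos : 0 < Z := hH.norm_pos
  set V := ∫ x, max x 0 ^ 2 * w x
  set K := ∫ x, 8 / t ^ 2 * (Real.exp (t * x) * w x + Real.exp (-t * x) * w x) with hKdef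
  have hiK : Integrable fun x =>
      8 / t ^ 2 * (Real.exp (t * x) * w x + Real.exp (-t * x) * w x) :=
    (hip.add him).const_mul _
  have hK0 : 0 ≤ K := integral_nonneg fun x => by
    have := hwpos x
    positivity
  refine ⟨Z, hZpos, V / (2 * Z), by positivity, (K + 1) / Z, by positivity, t / 2,
    by positivity, ?_, ?_⟩
  · rw [hmoment, hZ, ofReal_integral_eq_lintegral_ofReal hi0
      (Filter.Eventually.of_forall fun x => (hwpos x).le)]
    simp
  · intro s hs0 hst
    have his : Integrable fun x => Real.exp (s * x) * w x :=
      hint s (by rw [abs_of_nonneg hs0]; linarith)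
    rw [hmoment, ← ofReal_integral_eq_lintegral_ofReal his
      (Filter.Eventually.of_forall fun x => mul_nonneg (Real.exp_pos _).le (hwpos x).le)]
    have hmean : ∫ x, x * w x = 0 := hH.mean_zero
    have hadd : ∀ (b : ℝ) {g : ℝ → ℝ}, Integrable g →
        ∫ x, (w x + s * (x * w x) + b * g x) = Z + b * ∫ x, g x := by
      intro b g hg
      have hi01 : Integrable fun x => w x + s * (x * w x) := hi0.add (hi1.const_mul s)
      rw [integral_add hi01 (hg.const_mul b), integral_add hi0 (hi1.const_mul s),
        integral_const_mul, integral_const_mul, hmean, mul_zero, add_zero]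
    constructor
    · refine ENNReal.ofReal_le_ofReal ?_
      have hlow : ∫ x, (w x + s * (x * w x) + s ^ 2 / 2 * (max x 0 ^ 2 * w x)) ≤
          ∫ x, Real.exp (s * x) * w x := by
        refine integral_mono ((hi0.add (hi1.const_mul _)).add (hi3.const_mul _)) his
          fun x => ?_
        have h := mul_le_mul_of_nonneg_right (one_add_add_sq_max_le_exp (s * x)) (hwpos x).le
        have hmax : max (s * x) 0 = s * max x 0 := by
          rw [mul_max_of_nonneg _ _ hs0, mul_zero]
        rw [hmax] at h
        refine le_trans (le_of_eq ?_) h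
        ring
      rw [hadd _ hi3] at hlow
      refine le_trans (le_of_eq ?_) hlow
      field_simp
      ring
    · refine ENNReal.ofReal_le_ofReal ?_
      have hupp : ∫ x, Real.exp (s * x) * w x ≤ ∫ x, (w x + s * (x * w x) + s ^ 2 *
          (8 / t ^ 2 * (Real.exp (t * x) * w x + Real.exp (-t * x) * w x))) := by
        refine integral_mono his ((hi0.add (hi1.const_mul _)).add (hiK.const_mul _))
          fun x => ?_
        have h := mul_le_mul_of_nonneg_right (exp_mul_le_of_le (x := x) ht hs0 hst)
          (hwpos x).le
        refine h.trans (le_of_eq ?_)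
        ring
      rw [hadd _ hiK] at hupp
      have hexp := Real.add_one_le_exp ((K + 1) / Z * s ^ 2)
      have hmul : Z * ((K + 1) / Z * s ^ 2 + 1) = (K + 1) * s ^ 2 + Z := by
        field_simp
      have := mul_le_mul_of_nonneg_left hexp hZpos.le
      nlinarith [sq_nonneg s]

/-- Log-concavity of `exp (-H)` makes the transition kernel totally positive of order two. -/
lemma exp_neg_totallyPositive (hH : ConvexOn ℝ Set.univ H) {x y t s : ℝ} (hxy : x ≤ y)
    (hts : t ≤ s) :
    ENNReal.ofReal (Real.exp (-(H (x - s)))) * ENNReal.ofReal (Real.exp (-(H (y - t)))) ≤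
      ENNReal.ofReal (Real.exp (-(H (y - s)))) * ENNReal.ofReal (Real.exp (-(H (x - t)))) := by
  rw [← ENNReal.ofReal_mul (Real.exp_pos _).le, ← ENNReal.ofReal_mul (Real.exp_pos _).le,
    ← Real.exp_add, ← Real.exp_add]
  refine ENNReal.ofReal_le_ofReal (Real.exp_le_exp.2 ?_)
  suffices H (y - s) + H (x - t) ≤ H (x - s) + H (y - t) by linarith
  rcases (add_nonneg (sub_nonneg.2 hxy) (sub_nonneg.2 hts)).eq_or_lt with h0 | hpos
  · have h1 : x = y := by linarith
    have h2 : t = s := by linarith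
    rw [h1, h2]
  · set d := y - x + (s - t) with hd
    have hsum : (s - t) / d + (y - x) / d = 1 := by
      rw [← add_div, hd, add_comm]
      exact div_self hpos.ne'
    have hα : 0 ≤ (s - t) / d := div_nonneg (by linarith) hpos.le
    have hβ : 0 ≤ (y - x) / d := div_nonneg (by linarith) hpos.le
    have h1 := hH.2 (Set.mem_univ (x - s)) (Set.mem_univ (y - t)) hα hβ hsum
    have h2 := hH.2 (Set.mem_univ (y - t)) (Set.mem_univ (x - s)) hα hβ hsum
    simp only [smul_eq_mul] at h1 h2
    have e1 : (s - t) / d * (x - s) + (y - x) / d * (y - t) = y - s := by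
      field_simp
      rw [hd]
      ring
    have e2 : (s - t) / d * (y - t) + (y - x) / d * (x - s) = x - t := by
      field_simp
      rw [hd]
      ring
    rw [e1] at h1
    rw [e2] at h2
    calc H (y - s) + H (x - t) ≤ ((s - t) / d + (y - x) / d) * (H (x - s) + H (y - t)) := by
          linarith
      _ = _ := by rw [hsum, one_mul]

end Exponential

section Estimates

/-- A Paley–Zygmund type bound for the mass above `u` in terms of exponential moments. -/
lemma expMoment_le_add_setLIntegral_Ici {g : ℝ → ℝ≥0∞} (hg : Measurable g) {s δ : ℝ}
    (hs : 0 ≤ s) (hδ : 0 < δ) (u : ℝ) :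
    ENNReal.ofReal (Real.exp (-(s * u))) * expMoment g s ≤
      expMoment g 0 +
        ENNReal.ofReal (δ * Real.exp (-(2 * s * u))) * expMoment g (2 * s) +
        ENNReal.ofReal (1 / (4 * δ)) * ∫⁻ y in Set.Ici u, g y := by
  rw [← lintegral_indicator measurableSet_Ici]
  unfold expMoment
  rw [← lintegral_const_mul _ (by fun_prop), ← lintegral_const_mul _ (by fun_prop),
    ← lintegral_const_mul _ (hg.indicator measurableSet_Ici),
    ← lintegral_add_left (by fun_prop), ← lintegral_add_left (by fun_prop)]
  refine lintegral_mono fun y => ?_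
  simp only [← mul_assoc]
  rw [← ENNReal.ofReal_mul (Real.exp_pos _).le, ← ENNReal.ofReal_mul (by positivity),
    zero_mul, Real.exp_zero, ENNReal.ofReal_one, mul_assoc δ, ← Real.exp_add, ← Real.exp_add]
  set z := Real.exp (-(s * u) + s * y) with hz
  have hzpos : 0 < z := Real.exp_pos _
  have hz2 : Real.exp (-(2 * s * u) + 2 * s * y) = z ^ 2 := by
    rw [hz, ← Real.exp_nat_mul]
    congr 1
    push_cast
    ring
  rw [hz2]
  by_cases hy : u ≤ y
  · rw [Set.indicator_of_mem (Set.mem_Ici.2 hy), ← add_mul, ← add_mul]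
    gcongr
    rw [← ENNReal.ofReal_one, ← ENNReal.ofReal_add zero_le_one (by positivity),
      ← ENNReal.ofReal_add (by positivity) (by positivity)]
    refine ENNReal.ofReal_le_ofReal ?_
    have h : 0 ≤ δ * (z - 1 / (2 * δ)) ^ 2 := by positivity
    have h' : δ * (z - 1 / (2 * δ)) ^ 2 = δ * z ^ 2 - z + 1 / (4 * δ) := by
      field_simp
      ring
    linarith
  · have hz1 : z ≤ 1 := by
      rw [hz, Real.exp_le_one_iff]
      nlinarith [not_le.1 hy]
    calc _ ≤ 1 * g y := by
          gcongr
          exact ENNReal.ofReal_le_one.2 hz1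
      _ ≤ _ := by
          rw [add_assoc]
          exact le_self_add

/-- The walk ends above its starting point with probability bounded below. -/
lemma exists_le_setLIntegral_Ici {f : ℝ → ℝ≥0∞} (hf : Measurable f) {Z c C t : ℝ} (hZ : 0 < Z)
    (hc : 0 < c) (ht : 0 < t) (h0 : expMoment f 0 = ENNReal.ofReal Z)
    (hlow : ∀ s, 0 ≤ s → s ≤ t → ENNReal.ofReal (Z * (1 + c * s ^ 2)) ≤ expMoment f s)
    (hupp : ∀ s, 0 ≤ s → s ≤ t → expMoment f s ≤ ENNReal.ofReal (Z * Real.exp (C * s ^ 2))) :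
    ∃ p > 0, ∀ (n : ℕ) (u a : ℝ), ENNReal.ofReal (p * Z ^ (n + 1)) ≤
      ∫⁻ y in Set.Ici u, ((crossingDensities f u a n).1 + (crossingDensities f u a n).2) y := by
  set b := t / 2 with hb
  have hbpos : 0 < b := by positivity
  set E := Real.exp (C * (4 * b ^ 2)) with hE
  have hEpos : 0 < E := Real.exp_pos _
  set δ := c * b ^ 2 / (2 * E) with hδdef
  have hδ : 0 < δ := by positivity
  refine ⟨2 * δ * (c * b ^ 2), by positivity, fun n u a => ?_⟩
  obtain ⟨hm1, hm2⟩ := measurable_crossingDensities hf u a n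
  set P := ∫⁻ y in Set.Ici u,
    ((crossingDensities f u a n).1 + (crossingDensities f u a n).2) y with hP
  have hN : (0 : ℝ) < (n + 1 : ℕ) := by positivity
  set s := b / √(n + 1 : ℕ) with hs
  have hspos : 0 < s := by positivity
  have hs2 : (n + 1 : ℕ) * s ^ 2 = b ^ 2 := by
    rw [hs, div_pow, Real.sq_sqrt hN.le]
    field_simp
  have hsb : s ≤ b := by
    refine div_le_self hbpos.le (Real.one_le_sqrt.2 ?_)
    exact_mod_cast Nat.succ_pos n
  have key := expMoment_le_add_setLIntegral_Ici (hm1.add hm2) hspos.le hδ u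
  rw [expMoment_crossingDensities_add hf, expMoment_crossingDensities_add hf,
    expMoment_crossingDensities_add hf, ← mul_assoc, ← mul_assoc,
    ← ENNReal.ofReal_mul (Real.exp_pos _).le, ← ENNReal.ofReal_mul (by positivity),
    mul_assoc δ, ← Real.exp_add, ← Real.exp_add, neg_add_cancel, neg_add_cancel, zero_mul,
    Real.exp_zero, ENNReal.ofReal_one, one_mul, one_mul, mul_one, h0, ← hP] at key
  have hl : ENNReal.ofReal (Z ^ (n + 1) * (1 + c * b ^ 2)) ≤ expMoment f s ^ (n + 1) := by
    refine le_trans ?_ (pow_le_pow_left' (hlow s hspos.le (by linarith)) (n + 1))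
    rw [← ENNReal.ofReal_pow (by positivity), mul_pow]
    refine ENNReal.ofReal_le_ofReal (mul_le_mul_of_nonneg_left ?_ (by positivity))
    have hbern := one_add_mul_le_pow
      (show (-2 : ℝ) ≤ c * s ^ 2 by linarith [show 0 ≤ c * s ^ 2 by positivity]) (n + 1)
    refine le_trans (le_of_eq ?_) hbern
    rw [← hs2]
    ring
  have hu : expMoment f (2 * s) ^ (n + 1) ≤ ENNReal.ofReal (Z ^ (n + 1) * E) := by
    refine (pow_le_pow_left' (hupp (2 * s) (by positivity) (by linarith)) (n + 1)).trans ?_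
    rw [← ENNReal.ofReal_pow (by positivity), mul_pow, ← Real.exp_nat_mul, hE, ← hs2]
    refine ENNReal.ofReal_le_ofReal (le_of_eq ?_)
    ring_nf
  by_cases hPtop : P = ⊤
  · rw [hPtop]
    exact le_top
  have hZn : 0 < Z ^ (n + 1) := by positivity
  have hreal : ENNReal.ofReal (Z ^ (n + 1) * (1 + c * b ^ 2)) ≤
      ENNReal.ofReal (Z ^ (n + 1) + δ * (Z ^ (n + 1) * E) + 1 / (4 * δ) * P.toReal) := by
    rw [ENNReal.ofReal_add (by positivity) (by positivity),
      ENNReal.ofReal_add (by positivity) (by positivity), ENNReal.ofReal_mul hδ.le,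
      ENNReal.ofReal_mul (p := 1 / (4 * δ)) (by positivity), ENNReal.ofReal_toReal hPtop,
      ENNReal.ofReal_pow hZ.le]
    refine (hl.trans key).trans ?_
    rw [← ENNReal.ofReal_pow hZ.le]
    gcongr
  rw [ENNReal.ofReal_le_ofReal_iff (by positivity)] at hreal
  refine ENNReal.ofReal_le_of_le_toReal ?_
  have hδE : δ * (Z ^ (n + 1) * E) = Z ^ (n + 1) * (c * b ^ 2) / 2 := by
    rw [hδdef]
    field_simp
  rw [hδE] at hreal
  have h4 : 4 * δ * (1 / (4 * δ) * P.toReal) = P.toReal := by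
    field_simp
  have h5 : 4 * δ * (Z ^ (n + 1) * (c * b ^ 2) / 2) ≤ 4 * δ * (1 / (4 * δ) * P.toReal) :=
    mul_le_mul_of_nonneg_left (by linarith) (by positivity)
  rw [h4] at h5
  linarith

/-- The Chernoff bound for the probability that the walk climbs by `u`. -/
lemma exists_expMoment_crossingDensities_le {f : ℝ → ℝ≥0∞} (hf : Measurable f) {Z C t : ℝ}
    (hZ : 0 < Z) (hC : 0 < C) (ht : 0 < t) (h0 : expMoment f 0 = ENNReal.ofReal Z)
    (hlow : ∀ s, 0 ≤ s → s ≤ t → ENNReal.ofReal Z ≤ expMoment f s)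
    (hupp : ∀ s, 0 ≤ s → s ≤ t → expMoment f s ≤ ENNReal.ofReal (Z * Real.exp (C * s ^ 2))) :
    ∃ k > 0, ∀ (n : ℕ) (u : ℝ), 0 < u →
      expMoment (crossingDensities f u (2 * u) n).1 0 ≤
        ENNReal.ofReal (Real.exp (-(k * min (u ^ 2 / (n + 1 : ℕ)) u)) * Z ^ (n + 1)) := by
  refine ⟨min (t / 2) (1 / (4 * C)), by positivity, fun n u hu => ?_⟩
  have hN : (0 : ℝ) < (n + 1 : ℕ) := by positivity
  set N : ℝ := ((n + 1 : ℕ) : ℝ) with hNdef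
  set k := min (t / 2) (1 / (4 * C)) with hk
  set m := min (u ^ 2 / N) u
  have hmpos : 0 < m := by positivity
  set s := min t (u / (2 * C * N)) with hs
  have hs0 : 0 ≤ s := by positivity
  have hst : s ≤ t := min_le_left _ _
  have hs2 : 2 * C * N * s ≤ u := by
    have := min_le_right t (u / (2 * C * N))
    rwa [← hs, le_div_iff₀ (by positivity), mul_comm] at this
  have hsm : k * m ≤ s * u / 2 := by
    rcases min_choice t (u / (2 * C * N)) with h | h
    · rw [hs, h]
      calc k * m ≤ t / 2 * u := by
            gcongr
            · exact min_le_left _ _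
            · exact min_le_right _ _
        _ = _ := by ring
    · rw [hs, h]
      calc k * m ≤ 1 / (4 * C) * (u ^ 2 / N) := by
            gcongr
            · exact min_le_right _ _
            · exact min_le_left _ _
        _ = _ := by
            field_simp
            norm_num
  have hdoob := expMoment_crossingDensities_le hf u (2 * u) hs0
    (h0.trans_le (hlow s hs0 hst)) n
  have hA : ENNReal.ofReal (Real.exp (s * (2 * u))) *
      expMoment (crossingDensities f u (2 * u) n).1 0 ≤
      ENNReal.ofReal (Real.exp (s * (2 * u))) *
        ENNReal.ofReal (Real.exp (-(k * m)) * Z ^ (n + 1)) := by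
    refine (le_self_add.trans hdoob).trans ?_
    calc _ ≤ ENNReal.ofReal (Real.exp (s * u)) *
          ENNReal.ofReal (Z * Real.exp (C * s ^ 2)) ^ (n + 1) := by
          gcongr
          exact hupp s hs0 hst
      _ ≤ _ := by
          rw [← ENNReal.ofReal_pow (by positivity), ← ENNReal.ofReal_mul (by positivity),
            ← ENNReal.ofReal_mul (by positivity), mul_pow, ← Real.exp_nat_mul, ← hNdef]
          refine ENNReal.ofReal_le_ofReal ?_
          have hexp : Real.exp (s * u) * Real.exp (N * (C * s ^ 2)) ≤
              Real.exp (s * (2 * u)) * Real.exp (-(k * m)) := by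
            rw [← Real.exp_add, ← Real.exp_add, Real.exp_le_exp]
            nlinarith [mul_le_mul_of_nonneg_left hs2 hs0]
          calc _ = Real.exp (s * u) * Real.exp (N * (C * s ^ 2)) * Z ^ (n + 1) := by ring
            _ ≤ Real.exp (s * (2 * u)) * Real.exp (-(k * m)) * Z ^ (n + 1) := by gcongr
            _ = _ := by ring
  exact (ENNReal.mul_le_mul_iff_right (by positivity) ENNReal.ofReal_ne_top).1 hA

/-- Interpolating with the trivial bound `1` changes the prefactor of an exponential bound. -/
lemma min_one_mul_exp_le {K : ℝ} (hK : 0 < K) (x : ℝ) :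
    min 1 (K * Real.exp (-x)) ≤ 4 * Real.exp (-(1 / (1 + K) * x)) := by
  have hKe : K ≤ Real.exp K := by linarith [Real.add_one_le_exp K]
  have hle : min 1 (K * Real.exp (-x)) ≤ Real.exp (1 / (1 + K) * (K - x)) := by
    rcases le_total 0 (K - x) with h | h
    · exact (min_le_left _ _).trans (Real.one_le_exp (by positivity))
    · refine (min_le_right _ _).trans ?_
      calc K * Real.exp (-x) ≤ Real.exp K * Real.exp (-x) := by gcongr
        _ = Real.exp (K - x) := by rw [← Real.exp_add, sub_eq_add_neg]
        _ ≤ _ := by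
          rw [Real.exp_le_exp]
          have : 1 / (1 + K) ≤ 1 := by
            rw [div_le_one (by positivity)]
            linarith
          nlinarith
  refine hle.trans ?_
  have hsplit : 1 / (1 + K) * (K - x) = K / (1 + K) + -(1 / (1 + K) * x) := by ring
  rw [hsplit, Real.exp_add]
  gcongr
  have h1 : K / (1 + K) ≤ 1 := by
    rw [div_le_one (by positivity)]
    linarith
  calc Real.exp (K / (1 + K)) ≤ Real.exp 1 := by gcongr
    _ ≤ 4 := by linarith [Real.exp_one_lt_d9]

end Estimates

/-- Maximal inequality for a random walk bridge from `u` to `u` on `⟦0,N⟧`: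
there are `c > 0` and `N₀` such that for all `N ≥ N₀` and `u > 0`,
`P(max_{1 ≤ j ≤ N-1} X(j) > 2u) ≤ 4 exp(-c min(u²/N, u))`. -/
theorem bridge_maximal_inequality (H : ℝ → ℝ) (hH : RWAssumptions H) :
    ∃ c > 0, ∃ N₀ : ℕ, ∀ N : ℕ, N₀ ≤ N → ∀ u : ℝ, 0 < u →
      probOf (bridgeMeasure H u u (N - 1))
          {q | ∃ j, 1 ≤ j ∧ j ≤ N - 1 ∧ 2 * u < pathOf u u (N - 1) q j}
        ≤ ENNReal.ofReal (4 * Real.exp (-(c * min (u ^ 2 / N) u))) := by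
  obtain ⟨Z, hZ, b, hb, C, hC, t, ht, h0, hbounds⟩ := hH.exists_expMoment_bounds
  have hHm : Measurable H := hH.continuous.measurable
  set f : ℝ → ℝ≥0∞ := fun x => ENNReal.ofReal (Real.exp (-(H x)))
  have hf : Measurable f := by fun_prop
  obtain ⟨p, hp, hlow⟩ := exists_le_setLIntegral_Ici hf hZ hb ht h0
    (fun s h1 h2 => (hbounds s h1 h2).1) (fun s h1 h2 => (hbounds s h1 h2).2)
  obtain ⟨k, hk, hupp⟩ := exists_expMoment_crossingDensities_le hf hZ hC ht h0
    (fun s h1 h2 => (ENNReal.ofReal_le_ofReal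
      (le_mul_of_one_le_right hZ.le (by
        have : 0 ≤ b * s ^ 2 := by positivity
        linarith))).trans (hbounds s h1 h2).1)
    (fun s h1 h2 => (hbounds s h1 h2).2)
  refine ⟨1 / (1 + p⁻¹) * k, by positivity, 1, fun N hN u hu => ?_⟩
  obtain ⟨n, rfl⟩ : ∃ n, N = n + 1 := ⟨N - 1, by omega⟩
  set m := min (u ^ 2 / ((n + 1 : ℕ) : ℝ)) u
  change probOf (bridgeMeasure H u u n) (crossingSet u u (2 * u) n) ≤ _
  rw [mul_assoc]
  refine le_trans ?_ (ENNReal.ofReal_le_ofReal (min_one_mul_exp_le (inv_pos.2 hp) (k * m)))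
  rw [ENNReal.ofReal_min, ENNReal.ofReal_one]
  refine le_min (ENNReal.div_le_of_le_mul ?_) (ENNReal.div_le_of_le_mul ?_)
  · rw [one_mul]
    exact measure_mono (Set.subset_univ _)
  · rw [bridgeMeasure_crossingSet hHm, bridgeMeasure_univ hHm u u (2 * u)]
    have hq : ENNReal.ofReal (p * Z ^ (n + 1)) ≠ 0 := by
      rw [Ne, ENNReal.ofReal_eq_zero, not_le]
      positivity
    refine (ENNReal.mul_le_mul_iff_left hq ENNReal.ofReal_ne_top).1 ?_
    calc _ ≤ _ := mul_le_mul_right (hlow n u (2 * u)) _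
      _ ≤ _ := crossingDensities_mul_setLIntegral_le hf
          (fun x y t s hxy hts => exp_neg_totallyPositive hH.convex hxy hts) u (2 * u) u n
      _ ≤ _ := mul_le_mul_right (hupp n u hu) _
      _ = _ := by
        rw [mul_right_comm, ← ENNReal.ofReal_mul (by positivity), mul_comm]
        congr 2
        field_simp
        rfl
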